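/- Let n ∈ ℕ. An ℝ-linear map f : A → B with f(1_A) = n·1_B is an n-homomorphism (i.e. Φ_{n+1}(f; a₁,…,a_{n+1}) = 0 for all a₁,…,a_{n+1} ∈ A) if and only if ψ_k(f,a) = 0 for every a ∈ A and every k ≥ n+1; equivalently, if and only if for every a ∈ A the characteristic series R(f,a,z) is a polynomial in z of degree at most n. -/

import Mathlib

noncomputable section

variable {A B : Type*}

/-- The Frobenius forms `Φ_k(f; a₁, …, a_k)`, defined inductively by `Φ₀ = 1`
(so that `Φ₁(f; a) = f a`) and
`Φ_{k+1}(f; a₁, …, a_{k+1}) = f a₁ · Φ_k(f; a₂, …, a_{k+1})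
  − Σ_{i=2}^{k+1} Φ_k(f; a₂, …, a₁·aᵢ, …, a_{k+1})`. -/
def Phi [CommRing A] [CommRing B] [Algebra ℝ A] [Algebra ℝ B]
    (f : A →ₗ[ℝ] B) : (n : ℕ) → (Fin n → A) → B
  | 0, _ => 1
  | n + 1, a =>
      f (a 0) * Phi f n (fun i => a i.succ) -
        ∑ i : Fin n, Phi f n (Function.update (fun j => a j.succ) i (a 0 * a i.succ))

/-- The coefficients `ψ_k(f, a)` of the characteristic series, defined by `ψ₀ = 1` and,
for `k ≥ 1`, by the recursion `k·ψ_k(f,a) = Σ_{i=1}^{k} (−1)^{i−1} f(aⁱ)·ψ_{k−i}(f,a)`. -/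
def psi [CommRing A] [CommRing B] [Algebra ℝ A] [Algebra ℝ B]
    (f : A →ₗ[ℝ] B) (a : A) : ℕ → B
  | 0 => 1
  | k + 1 =>
      (((k : ℝ) + 1)⁻¹) • ∑ j ∈ Finset.range (k + 1),
        ((-1 : B) ^ j * f (a ^ (j + 1)) * psi f a (k - j))
  decreasing_by exact Nat.lt_succ_of_le (Nat.sub_le k j)

theorem Phi_cons [CommRing A] [CommRing B] [Algebra ℝ A] [Algebra ℝ B]
    (f : A →ₗ[ℝ] B) {n : ℕ} (x : A) (t : Fin n → A) :
    Phi f (n + 1) (Fin.cons x t) =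
      f x * Phi f n t - ∑ i, Phi f n (Function.update t i (x * t i)) := by
  simp [Phi]

theorem Phi_update_add [CommRing A] [CommRing B] [Algebra ℝ A] [Algebra ℝ B]
    (f : A →ₗ[ℝ] B) {n : ℕ} (a : Fin n → A) (i : Fin n) (x y : A) :
    Phi f n (Function.update a i (x + y)) =
      Phi f n (Function.update a i x) + Phi f n (Function.update a i y) := by
  induction n generalizing x y with
  | zero => exact i.elim0
  | succ n ih =>
    induction a using Fin.consCases with | cons b t =>
    induction i using Fin.cases with
    | zero =>
      simp only [Fin.update_cons_zero, Phi_cons, map_add, add_mul, ih, Finset.sum_add_distrib]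
      ring
    | succ i =>
      have h : ∀ z, ∑ j, Phi f n (Function.update (Function.update t i z) j
          (b * Function.update t i z j)) = Phi f n (Function.update t i (b * z)) +
          ∑ j ∈ Finset.univ.erase i,
            Phi f n (Function.update (Function.update t j (b * t j)) i z) := by
        intro z
        rw [← Finset.add_sum_erase _ _ (Finset.mem_univ i)]
        congr 1
        · simp
        · refine Finset.sum_congr rfl fun j hj => ?_
          have hj := Finset.ne_of_mem_erase hj
          rw [Function.update_of_ne hj, Function.update_comm hj.symm]
      simp only [← Fin.cons_update, Phi_cons, h, mul_add, ih, Finset.sum_add_distrib]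
      ring

theorem Phi_update_smul [CommRing A] [CommRing B] [Algebra ℝ A] [Algebra ℝ B]
    (f : A →ₗ[ℝ] B) {n : ℕ} (a : Fin n → A) (i : Fin n) (c : ℝ) (x : A) :
    Phi f n (Function.update a i (c • x)) = c • Phi f n (Function.update a i x) := by
  induction n generalizing x with
  | zero => exact i.elim0
  | succ n ih =>
    induction a using Fin.consCases with | cons b t =>
    induction i using Fin.cases with
    | zero =>
      simp only [Fin.update_cons_zero, Phi_cons, map_smul, smul_mul_assoc, ih, smul_sub,
        Finset.smul_sum]
    | succ i =>
      simp only [← Fin.cons_update, Phi_cons, ih, smul_sub, Finset.smul_sum, mul_smul_comm]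
      congr 1
      refine Finset.sum_congr rfl fun j _ => ?_
      by_cases hj : j = i
      · subst hj
        simp [ih]
      · simp only [Function.update_of_ne hj]
        rw [Function.update_comm (Ne.symm hj), ih, Function.update_comm (Ne.symm hj)]

/-- The Frobenius form `Φ_n(f; ·)` as a multilinear map. -/
def multilinearPhi [CommRing A] [CommRing B] [Algebra ℝ A] [Algebra ℝ B]
    (f : A →ₗ[ℝ] B) (n : ℕ) : MultilinearMap ℝ (fun _ : Fin n => A) B where
  toFun := Phi f n
  map_update_add' {inst} a i x y := by
    rw [Subsingleton.elim inst (instDecidableEqFin n)]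
    exact Phi_update_add f a i x y
  map_update_smul' {inst} a i c x := by
    rw [Subsingleton.elim inst (instDecidableEqFin n)]
    exact Phi_update_smul f a i c x

theorem Phi_cons_cons_swap [CommRing A] [CommRing B] [Algebra ℝ A] [Algebra ℝ B]
    (f : A →ₗ[ℝ] B) {n : ℕ} (x y : A) (t : Fin n → A) :
    Phi f (n + 2) (Fin.cons x (Fin.cons y t : Fin (n + 1) → A)) =
      Phi f (n + 2) (Fin.cons y (Fin.cons x t : Fin (n + 1) → A)) := by
  have h : ∑ i, ∑ j, Phi f n (Function.update (Function.update t i (x * t i)) j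
        (y * Function.update t i (x * t i) j)) =
      ∑ i, ∑ j, Phi f n (Function.update (Function.update t i (y * t i)) j
        (x * Function.update t i (y * t i) j)) := by
    rw [Finset.sum_comm]
    refine Finset.sum_congr rfl fun j _ => Finset.sum_congr rfl fun i _ => ?_
    by_cases hij : i = j
    · subst hij
      simp [mul_left_comm]
    · rw [Function.update_of_ne hij, Function.update_of_ne (Ne.symm hij),
        Function.update_comm hij]
  simp only [Phi_cons, Fin.sum_univ_succ, Fin.cons_zero, Fin.cons_succ, Fin.update_cons_zero,
    ← Fin.cons_update, Finset.sum_sub_distrib, ← Finset.mul_sum, h, mul_comm y x]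
  ring

theorem Phi_comp_swap [CommRing A] [CommRing B] [Algebra ℝ A] [Algebra ℝ B]
    (f : A →ₗ[ℝ] B) {n : ℕ} (i : Fin n) (a : Fin (n + 1) → A) :
    Phi f (n + 1) (a ∘ Equiv.swap i.castSucc i.succ) = Phi f (n + 1) a := by
  induction n with
  | zero => exact i.elim0
  | succ n ih =>
    induction i using Fin.cases with
    | zero =>
      induction a using Fin.consCases with | cons x t =>
      induction t using Fin.consCases with | cons y t =>
      rw [← Phi_cons_cons_swap]
      congr 1
      funext j
      induction j using Fin.cases with
      | zero => simp
      | succ j =>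
        induction j using Fin.cases with
        | zero => simp
        | succ j =>
          rw [Function.comp_apply, Equiv.swap_apply_of_ne_of_ne]
          · simp
          · simp
          · simp [Fin.ext_iff]
    | succ i =>
      have h0 : Equiv.swap i.succ.castSucc i.succ.succ 0 = 0 :=
        Equiv.swap_apply_of_ne_of_ne (by simp [Fin.ext_iff]) (by simp [Fin.ext_iff])
      have hs : ∀ j : Fin (n + 1), Equiv.swap i.succ.castSucc i.succ.succ j.succ =
          (Equiv.swap i.castSucc i.succ j).succ := fun j => by
        rw [← Fin.succ_castSucc]
        exact (Fin.succ_injective _).swap_apply _ _ _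
      have ha : a ∘ Equiv.swap i.succ.castSucc i.succ.succ =
          Fin.cons (a 0) (Fin.tail a ∘ Equiv.swap i.castSucc i.succ) := by
        funext j
        induction j using Fin.cases with
        | zero => exact congrArg a h0
        | succ j => exact congrArg a (hs j)
      rw [ha]
      conv_rhs => rw [← Fin.cons_self_tail a]
      rw [Phi_cons, Phi_cons, ih]
      congr 1
      rw [← Equiv.sum_comp (Equiv.swap i.castSucc i.succ)]
      refine Finset.sum_congr rfl fun j _ => ?_
      rw [← ih i (Function.update (Fin.tail a) _ _), Function.update_comp_equiv]
      simp

theorem Phi_comp_perm [CommRing A] [CommRing B] [Algebra ℝ A] [Algebra ℝ B]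
    (f : A →ₗ[ℝ] B) {n : ℕ} (σ : Equiv.Perm (Fin n)) (a : Fin n → A) :
    Phi f n (a ∘ σ) = Phi f n a := by
  cases n with
  | zero => exact congrArg _ (Subsingleton.elim _ _)
  | succ n =>
    have hσ : σ ∈ Submonoid.closure
        (Set.range fun i : Fin n => Equiv.swap i.castSucc i.succ) := by
      rw [Equiv.Perm.mclosure_swap_castSucc_succ]
      trivial
    induction hσ using Submonoid.closure_induction generalizing a with
    | mem σ h =>
      obtain ⟨i, rfl⟩ := h
      exact Phi_comp_swap f i a
    | one => rfl
    | mul σ τ _ _ hσ hτ =>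
      rw [Equiv.Perm.coe_mul, ← Function.comp_assoc, hτ, hσ]

/-- Inclusion–exclusion weights: the alternating sum over subsets of the coefficient of
`v ∘ r` detects surjectivity of `r`. -/
theorem sum_prod_sign_mul_prod_indicator {n : ℕ} (r : Fin n → Fin n) :
    ∑ e : Fin n → Bool, (∏ j, if e j then (1 : ℝ) else -1) *
        ∏ i, (if e (r i) then (1 : ℝ) else 0) =
      if Function.Surjective r then 1 else 0 := by
  have h : ∀ e : Fin n → Bool,
      (∏ j, if e j then (1 : ℝ) else -1) * ∏ i, (if e (r i) then (1 : ℝ) else 0) =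
      ∏ j, (if e j then (1 : ℝ) else -1) *
        (if e j then (1 : ℝ) else 0) ^ (Finset.univ.filter fun i => r i = j).card := by
    intro e
    rw [Finset.prod_mul_distrib]
    congr 1
    rw [← Finset.prod_fiberwise (s := Finset.univ) (g := r)]
    refine Finset.prod_congr rfl fun j _ => ?_
    rw [← Finset.prod_const]
    exact Finset.prod_congr rfl fun i hi => by rw [(Finset.mem_filter.1 hi).2]
  simp_rw [h]
  rw [← Fintype.piFinset_univ, ← Finset.prod_univ_sum (fun _ => Finset.univ)
    (fun j (b : Bool) => (if b then (1 : ℝ) else -1) *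
        (if b then (1 : ℝ) else 0) ^ (Finset.univ.filter fun i => r i = j).card)]
  split_ifs with hr
  · refine Finset.prod_eq_one fun j _ => ?_
    obtain ⟨i, hi⟩ := hr j
    have : (Finset.univ.filter fun i => r i = j).card ≠ 0 :=
      Finset.card_ne_zero_of_mem (Finset.mem_filter.2 ⟨Finset.mem_univ i, hi⟩)
    simp [this]
  · simp only [Function.Surjective, not_forall, not_exists] at hr
    obtain ⟨j, hj⟩ := hr
    refine Finset.prod_eq_zero (Finset.mem_univ j) ?_
    simp [Finset.filter_false_of_mem fun i _ => hj i]

/-- A symmetric multilinear map vanishing on the diagonal is zero. -/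
theorem MultilinearMap.eq_zero_of_symmetric_of_diagonal {M N : Type*} [AddCommGroup M] [Module ℝ M]
    [AddCommGroup N] [Module ℝ N] {n : ℕ} (F : MultilinearMap ℝ (fun _ : Fin n => M) N)
    (hsymm : ∀ (σ : Equiv.Perm (Fin n)) (v : Fin n → M), F (v ∘ σ) = F v)
    (hdiag : ∀ x : M, F (fun _ => x) = 0) : F = 0 := by
  classical
  ext v
  have h1 : ∑ e : Fin n → Bool, (∏ j, if e j then (1 : ℝ) else -1) •
      F (fun _ => ∑ j, (if e j then (1 : ℝ) else 0) • v j) = 0 := by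
    simp [hdiag]
  have h2 : ∑ r : Fin n → Fin n,
      (if Function.Surjective r then (1 : ℝ) else 0) • F (v ∘ r) = 0 := by
    rw [← h1]
    simp_rw [F.map_sum, F.map_smul_univ, Finset.smul_sum, smul_smul]
    rw [Finset.sum_comm]
    refine Finset.sum_congr rfl fun r _ => ?_
    rw [← Finset.sum_smul, sum_prod_sign_mul_prod_indicator]
    rfl
  have h3 : ∀ r : Fin n → Fin n, (if Function.Surjective r then (1 : ℝ) else 0) • F (v ∘ r) =
      (if Function.Surjective r then (1 : ℝ) else 0) • F v := by
    intro r
    split_ifs with hr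
    · rw [← hsymm (Equiv.ofBijective r (Finite.surjective_iff_bijective.1 hr)) v]
      rfl
    · simp
  simp_rw [h3] at h2
  rw [← Finset.sum_smul] at h2
  refine (smul_eq_zero_iff_right ?_).1 h2
  refine (Finset.sum_pos' (fun r _ => by split_ifs <;> norm_num)
    ⟨id, Finset.mem_univ _, by simp [Function.surjective_id]⟩).ne'

theorem Phi_update_const [CommRing A] [CommRing B] [Algebra ℝ A] [Algebra ℝ B]
    (f : A →ₗ[ℝ] B) {n : ℕ} (a b : A) (i : Fin (n + 1)) :
    Phi f (n + 1) (Function.update (fun _ => a) i b) =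
      Phi f (n + 1) (Fin.cons b fun _ => a) := by
  rw [← Phi_comp_perm f (Equiv.swap 0 i)]
  congr 1
  funext j
  induction j using Fin.cases with
  | zero => simp
  | succ j =>
    rw [Function.comp_apply, Function.update_of_ne, Fin.cons_succ]
    intro h
    rw [Equiv.swap_apply_eq_iff, Equiv.swap_apply_right] at h
    exact Fin.succ_ne_zero _ h

theorem succ_smul_psi_succ [CommRing A] [CommRing B] [Algebra ℝ A] [Algebra ℝ B]
    (f : A →ₗ[ℝ] B) (a : A) (k : ℕ) :
    ((k : ℝ) + 1) • psi f a (k + 1) =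
      ∑ j ∈ Finset.range (k + 1), (-1 : B) ^ j * f (a ^ (j + 1)) * psi f a (k - j) := by
  rw [psi, smul_smul, mul_inv_cancel₀ (by positivity), one_smul]

theorem Phi_cons_pow [CommRing A] [CommRing B] [Algebra ℝ A] [Algebra ℝ B]
    (f : A →ₗ[ℝ] B) (a : A) (k : ℕ)
    (h : ∀ m ≤ k, Phi f m (fun _ => a) = (m.factorial : ℝ) • psi f a m) (p : ℕ) :
    Phi f (k + 1) (Fin.cons (a ^ p) fun _ => a) =
      (k.factorial : ℝ) •
        ∑ j ∈ Finset.range (k + 1), (-1 : B) ^ j * f (a ^ (p + j)) * psi f a (k - j) := by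
  induction k generalizing p with
  | zero => simp [Phi, psi]
  | succ k ih =>
    rw [Phi_cons, h _ le_rfl]
    simp only [Phi_update_const, ← pow_succ]
    rw [ih (fun m hm => h m (hm.trans k.le_succ)), Finset.sum_const, Finset.card_univ,
      Fintype.card_fin, Finset.sum_range_succ' _ (k + 1), ← Nat.cast_smul_eq_nsmul ℝ, smul_smul,
      ← Nat.cast_mul, ← Nat.factorial_succ, mul_smul_comm, ← smul_sub]
    congr 1
    rw [sub_eq_add_neg, ← Finset.sum_neg_distrib, add_comm]
    congr 1
    · refine Finset.sum_congr rfl fun j _ => ?_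
      rw [Nat.add_sub_add_right, show p + 1 + j = p + (j + 1) by ring]
      ring
    · simp

/-- On the diagonal, the Frobenius forms are the coefficients of the characteristic series up to
a factorial. -/
theorem Phi_diagonal [CommRing A] [CommRing B] [Algebra ℝ A] [Algebra ℝ B]
    (f : A →ₗ[ℝ] B) (a : A) (k : ℕ) :
    Phi f k (fun _ => a) = (k.factorial : ℝ) • psi f a k := by
  induction k using Nat.strong_induction_on with | _ k ih =>
  cases k with
  | zero => simp [Phi, psi]
  | succ k =>
    have hcons : (fun _ : Fin (k + 1) => a) = Fin.cons (a ^ 1) fun _ => a := by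
      funext j
      induction j using Fin.cases <;> simp
    rw [hcons, Phi_cons_pow f a k fun m hm => ih m (Nat.lt_succ_of_le hm)]
    simp only [add_comm 1]
    rw [← succ_smul_psi_succ, smul_smul, Nat.factorial_succ]
    push_cast
    rw [mul_comm]

theorem Phi_eq_zero_of_le [CommRing A] [CommRing B] [Algebra ℝ A] [Algebra ℝ B]
    (f : A →ₗ[ℝ] B) {m k : ℕ} (hmk : m ≤ k) (h : ∀ a, Phi f m a = 0) (a : Fin k → A) :
    Phi f k a = 0 := by
  induction k, hmk using Nat.le_induction with
  | base => exact h a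
  | succ k _ ih => simp [Phi, ih]

/-- For an `ℝ`-linear map `f : A → B` with `f 1 = n·1`, the following are equivalent:
`f` is an `n`-homomorphism (`Φ_{n+1}(f; ·) ≡ 0`); `ψ_k(f,a) = 0` for all `a` and all
`k ≥ n+1`; for every `a` the characteristic series `R(f,a,z)` is a polynomial of
degree at most `n`. -/
theorem nHom_iff_psi_iff_poly [CommRing A] [CommRing B] [Algebra ℝ A] [Algebra ℝ B]
    (n : ℕ) (f : A →ₗ[ℝ] B) (hf : f 1 = (n : B)) :
    ((∀ a : Fin (n + 1) → A, Phi f (n + 1) a = 0) ↔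
        ∀ a : A, ∀ k : ℕ, n + 1 ≤ k → psi f a k = 0) ∧
      ((∀ a : A, ∀ k : ℕ, n + 1 ≤ k → psi f a k = 0) ↔
        ∀ a : A, ∃ P : Polynomial B, P.natDegree ≤ n ∧
          PowerSeries.mk (psi f a) = (P : PowerSeries B)) := by
  refine ⟨⟨fun h a k hk => ?_, fun h => ?_⟩, ⟨fun h a => ?_, fun h a k hk => ?_⟩⟩
  · have := Phi_diagonal f a k
    rw [Phi_eq_zero_of_le f hk h] at this
    exact (smul_eq_zero_iff_right (Nat.cast_ne_zero.2 k.factorial_ne_zero)).1 this.symm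
  · have hF : multilinearPhi f (n + 1) = 0 :=
      MultilinearMap.eq_zero_of_symmetric_of_diagonal _ (Phi_comp_perm f) fun x => by
        rw [multilinearPhi, MultilinearMap.coe_mk, Phi_diagonal, h x _ le_rfl, smul_zero]
    exact fun a => DFunLike.congr_fun hF a
  · refine ⟨PowerSeries.trunc (n + 1) (PowerSeries.mk (psi f a)),
      Nat.le_of_lt_succ (PowerSeries.natDegree_trunc_lt _ _), ?_⟩
    ext k
    rw [Polynomial.coeff_coe, PowerSeries.coeff_trunc, PowerSeries.coeff_mk]
    split_ifs with hk
    · rfl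
    · exact h a k (not_lt.1 hk)
  · obtain ⟨P, hP, hR⟩ := h a
    rw [← PowerSeries.coeff_mk k (psi f a), hR, Polynomial.coeff_coe]
    exact Polynomial.coeff_eq_zero_of_natDegree_lt (lt_of_le_of_lt hP hk)

end
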